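/- Let A be a complete atomic weakly associative relation algebra. Then there exist a set U, a symmetric and reflexive binary relation S ⊆ U×U, and a set A' of binary relations on U which contains Id_U and is closed under arbitrary unions, complementation relative to U×U, relational composition, and inverse (a complete set relation algebra on U), such that A is isomorphic to the relativization Rl_S(A'); that is, there is a bijection G from A onto {R∩S : R ∈ A'} with G(x+y) = G(x)∪G(y), G(‾x) = S∖G(x), G(x;y) = (G(x)|G(y))∩S, G(x⌣) = G(x)⁻¹∩S, and G(1') = Id_U∩S for all x,y ∈ A. -/

import Mathlib

universe u

/-- A weakly associative relation algebra: a Boolean algebra equipped with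
relative multiplication `comp`, converse `conv`, and identity `one'`
satisfying the WA axioms. -/
structure WA (A : Type*) [BooleanAlgebra A] where
  comp : A → A → A
  conv : A → A
  one' : A
  wassoc : ∀ x : A, comp (comp (x ⊓ one') ⊤) ⊤ = comp (x ⊓ one') ⊤
  rdist : ∀ x y z : A, comp (x ⊔ y) z = comp x z ⊔ comp y z
  comp_one' : ∀ x : A, comp x one' = x
  conv_conv : ∀ x : A, conv (conv x) = x
  conv_sup : ∀ x y : A, conv (x ⊔ y) = conv x ⊔ conv y
  conv_comp : ∀ x y : A, conv (comp x y) = comp (conv y) (conv x)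
  tarski : ∀ x y : A, comp (conv x) (comp x y)ᶜ ≤ yᶜ

/-- Relational composition of binary relations. -/
def relComp {U : Type*} (R S : Set (U × U)) : Set (U × U) :=
  {p | ∃ w, (p.1, w) ∈ R ∧ (w, p.2) ∈ S}

/-- Inverse of a binary relation. -/
def relInv {U : Type*} (R : Set (U × U)) : Set (U × U) :=
  {p | (p.2, p.1) ∈ R}

/-- The identity relation. -/
def idRel' {U : Type*} : Set (U × U) :=
  {p | p.1 = p.2}

/-- The atom structure of a weakly associative relation algebra: a ternary relation of cycles
(`cycle a b c` stands for `c ≤ a ; b`), converse, and the identity atom `src a` at the start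
of `a`. -/
structure CycleStructure (X : Type u) where
  cycle : X → X → X → Prop
  conv : X → X
  src : X → X
  conv_conv : ∀ a, conv (conv a) = a
  src_src : ∀ a, src (src a) = src a
  conv_src : ∀ a, conv (src a) = src a
  cycle_rotate : ∀ {a b c}, cycle a b c → cycle (conv a) c b
  cycle_conv : ∀ {a b c}, cycle a b c → cycle (conv b) (conv a) (conv c)
  src_eq_of_cycle : ∀ {a b c}, cycle a b c → src c = src a
  cycle_src : ∀ a, cycle (src a) a a
  eq_of_cycle_src : ∀ {a b c}, cycle (src a) b c → b = c

namespace CycleStructure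

variable {X : Type u} (F : CycleStructure X)

lemma src_conv_of_cycle {a b c : X} (h : F.cycle a b c) : F.src (F.conv a) = F.src b :=
  (F.src_eq_of_cycle (F.cycle_rotate h)).symm

lemma cycle_conv_src (a : X) : F.cycle a (F.conv a) (F.src a) := by
  have h := F.cycle_rotate (F.cycle_conv (F.cycle_src a))
  rwa [F.conv_src, F.conv_conv] at h

lemma cycle_src_conv (a : X) : F.cycle a (F.src (F.conv a)) a := by
  have h := F.cycle_conv (F.cycle_src (F.conv a))
  rwa [F.conv_src, F.conv_conv] at h

lemma conv_eq_self {a : X} (h : F.src a = a) : F.conv a = a := by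
  rw [← h, F.conv_src]

lemma eq_of_cycle_left {a b c : X} (ha : F.src a = a) (h : F.cycle a b c) : b = c := by
  rw [← ha] at h
  exact F.eq_of_cycle_src h

lemma eq_of_cycle_right {a b c : X} (hb : F.src b = b) (h : F.cycle a b c) : a = c := by
  have h' := F.cycle_conv h
  rw [F.conv_eq_self hb] at h'
  rw [← F.conv_conv a, F.eq_of_cycle_left hb h', F.conv_conv]

lemma eq_conv_of_cycle {a b c : X} (hc : F.src c = c) (h : F.cycle a b c) : b = F.conv a := by
  have h' := F.cycle_rotate h
  exact (F.eq_of_cycle_right hc h').symm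

lemma src_conv_ne {a : X} (h : F.src a ≠ a) : F.src (F.conv a) ≠ F.conv a := by
  intro h'
  have := F.conv_eq_self h'
  rw [F.conv_conv] at this
  rw [← this] at h'
  exact h h'

open Classical in
/-- An injective code of the labels in an abelian group that turns converse into negation. -/
noncomputable def code (a : X) : X → ZMod 4 := fun x =>
  if x = a then (if x = F.conv a then 2 else 1) else (if x = F.conv a then 3 else 0)

lemma code_conv (a : X) : F.code (F.conv a) = -F.code a := by
  funext x
  have hc := F.conv_conv a
  simp only [code, Pi.neg_apply]
  split_ifs <;> first | decide | grind

lemma code_injective : Function.Injective F.code := by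
  intro a b h
  have h' := congrFun h a
  simp only [code] at h'
  by_contra hab
  revert h'
  simp only [if_true, if_neg hab]
  split_ifs <;> decide

/-- The vertices of a homogeneous labelled graph in which any two labels can be amalgamated. -/
structure Vertex where
  part : Fin 3
  type : {e : X // F.src e = e}
  val : Fin 3 → X → ZMod 4

/-- The labelled edges of the homogeneous graph on `Vertex`. -/
def Lab (x y : F.Vertex) (a : X) : Prop :=
  F.src a ≠ a ∧ x.part ≠ y.part ∧ F.src a = x.type ∧ F.src (F.conv a) = y.type ∧
    x.val y.part - y.val x.part = F.code a

variable {F}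

lemma Lab.unique {x y : F.Vertex} {a b : X} (ha : F.Lab x y a) (hb : F.Lab x y b) : a = b :=
  F.code_injective (ha.2.2.2.2.symm.trans hb.2.2.2.2)

lemma Lab.ne {x y : F.Vertex} {a : X} (ha : F.Lab x y a) : x ≠ y :=
  fun h => ha.2.1 (congrArg Vertex.part h)

lemma Lab.conv {x y : F.Vertex} {a : X} (h : F.Lab x y a) : F.Lab y x (F.conv a) := by
  obtain ⟨h1, h2, h3, h4, h5⟩ := h
  refine ⟨F.src_conv_ne h1, h2.symm, h4, by rwa [F.conv_conv], ?_⟩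
  rw [code_conv, ← h5, neg_sub]

lemma exists_lab (x : F.Vertex) {a : X} (ha : F.src a ≠ a) (hx : F.src a = x.type) :
    ∃ z, F.Lab x z a := by
  obtain ⟨j, hj⟩ : ∃ j, x.part ≠ j := ⟨x.part + 1, by generalize x.part = p; revert p; decide⟩
  exact ⟨⟨j, ⟨F.src (F.conv a), F.src_src _⟩, fun _ => x.val j - F.code a⟩, ha, hj, hx, rfl,
    sub_sub_cancel _ _⟩

lemma exists_lab_lab {x y : F.Vertex} (hxy : x.part ≠ y.part) {a b : X} (ha : F.src a ≠ a)
    (hb : F.src b ≠ b) (hx : F.src a = x.type) (hab : F.src (F.conv a) = F.src b)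
    (hy : F.src (F.conv b) = y.type) : ∃ z, F.Lab x z a ∧ F.Lab z y b := by
  obtain ⟨j, hxj, hjy⟩ : ∃ j, x.part ≠ j ∧ j ≠ y.part := by
    generalize x.part = p at hxy
    generalize y.part = q at hxy
    revert p q
    decide
  refine ⟨⟨j, ⟨F.src b, F.src_src _⟩,
    fun i => if i = x.part then x.val j - F.code a else F.code b + y.val j⟩,
    ⟨ha, hxj, hx, hab, ?_⟩, ⟨hb, hjy, rfl, hy, ?_⟩⟩
  · simp
  · simp [hxy.symm]

/-- The automorphism of the homogeneous graph that permutes the parts and then translates. -/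
def Vertex.perm (σ : Equiv.Perm (Fin 3)) (τ : Fin 3 → Fin 3 → X → ZMod 4) :
    Equiv.Perm F.Vertex where
  toFun x := ⟨σ x.part, x.type, fun j => x.val (σ.symm j) + τ (σ x.part) j⟩
  invFun x := ⟨σ.symm x.part, x.type, fun j => x.val (σ j) - τ x.part (σ j)⟩
  left_inv x := by simp
  right_inv x := by simp

lemma lab_perm_iff (σ : Equiv.Perm (Fin 3)) {τ : Fin 3 → Fin 3 → X → ZMod 4}
    (hτ : ∀ i j, τ i j = τ j i) (x y : F.Vertex) (a : X) :
    F.Lab (Vertex.perm σ τ x) (Vertex.perm σ τ y) a ↔ F.Lab x y a := by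
  simp [Lab, Vertex.perm, hτ (σ x.part) (σ y.part)]

/-- The permutations of the vertices that preserve types and labelled edges. -/
def IsAut (h : Equiv.Perm F.Vertex) : Prop :=
  (∀ x, (h x).type = x.type) ∧ ∀ x y a, F.Lab (h x) (h y) a ↔ F.Lab x y a

lemma isAut_perm (σ : Equiv.Perm (Fin 3)) {τ : Fin 3 → Fin 3 → X → ZMod 4}
    (hτ : ∀ i j, τ i j = τ j i) : IsAut (F := F) (Vertex.perm σ τ) :=
  ⟨fun _ => rfl, lab_perm_iff σ hτ⟩

lemma exists_isAut_vertex {x y : F.Vertex} (h : x.type = y.type) :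
    ∃ g : Equiv.Perm F.Vertex, IsAut g ∧ g x = y := by
  obtain ⟨p, e, f⟩ := x
  obtain ⟨q, e', g⟩ := y
  obtain rfl : e = e' := h
  let d : Fin 3 → X → ZMod 4 := fun j => g j - f ((Equiv.swap p q).symm j)
  refine ⟨Vertex.perm (Equiv.swap p q) fun i j =>
    if i = q then d j else if j = q then d i else 0, isAut_perm _ ?_, ?_⟩
  · intro i j
    by_cases hi : i = q <;> by_cases hj : j = q <;> simp [hi, hj]
  · simp [Vertex.perm, d]

lemma exists_isAut_edge {x y x' y' : F.Vertex} {a : X} (h : F.Lab x y a) (h' : F.Lab x' y' a) :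
    ∃ g : Equiv.Perm F.Vertex, IsAut g ∧ g x = x' ∧ g y = y' := by
  obtain ⟨-, hp, hx, hy, hv⟩ := h
  obtain ⟨-, hp', hx', hy', hv'⟩ := h'
  have e1 := Subtype.ext (hx.symm.trans hx')
  have e2 := Subtype.ext (hy.symm.trans hy')
  obtain ⟨p, e, f⟩ := x
  obtain ⟨q, c, g⟩ := y
  obtain ⟨p', e', f'⟩ := x'
  obtain ⟨q', c', g'⟩ := y'
  dsimp only at hp hp' hv hv' e1 e2
  subst e1 e2
  obtain ⟨σ, rfl, rfl⟩ : ∃ σ : Equiv.Perm (Fin 3), σ p = p' ∧ σ q = q' := by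
    clear hx hx' hy hy' hv hv'
    revert p q p' q'
    decide
  let d : Fin 3 → X → ZMod 4 := fun j => f' j - f (σ.symm j)
  let d' : Fin 3 → X → ZMod 4 := fun j => g' j - g (σ.symm j)
  have hd : d (σ q) = d' (σ p) := by
    simp only [d, d', Equiv.symm_apply_apply]
    rw [sub_eq_sub_iff_sub_eq_sub, hv, hv']
  refine ⟨Vertex.perm σ fun i j =>
    if i = σ p then d j else if j = σ p then d i else
    if i = σ q then d' j else if j = σ q then d' i else 0, isAut_perm _ ?_, ?_, ?_⟩
  · intro i j
    by_cases hi : i = σ p <;> by_cases hj : j = σ p <;> by_cases hi' : i = σ q <;>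
      by_cases hj' : j = σ q <;> simp_all
  · simp [Vertex.perm, d]
  · simp only [Vertex.perm, Equiv.coe_fn_mk, Vertex.mk.injEq, true_and]
    funext j
    by_cases hj : j = σ p
    · subst hj
      simp [hp'.symm, hd, d']
    · simp [hp'.symm, hj, d']

variable (F) in
/-- The labels of a triangle form a cycle. -/
def Consistent (x y z : F.Vertex) : Prop :=
  ∀ a b c, F.Lab x y a → F.Lab y z b → F.Lab x z c → F.cycle a b c

lemma Consistent.swap_left {x y z : F.Vertex} (h : F.Consistent x y z) :
    F.Consistent y x z := by
  intro a b c ha hb hc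
  have := F.cycle_rotate (h _ _ _ ha.conv hc hb)
  rwa [F.conv_conv] at this

lemma Consistent.reverse {x y z : F.Vertex} (h : F.Consistent x y z) :
    F.Consistent z y x := by
  intro a b c ha hb hc
  have := F.cycle_conv (h _ _ _ hb.conv ha.conv hc.conv)
  rwa [F.conv_conv, F.conv_conv, F.conv_conv] at this

variable (F) in
/-- The vertex sets of the triangles whose labels do not form a cycle. -/
def Bad (M : Set F.Vertex) : Prop :=
  ∃ x y z, M = {x, y, z} ∧ ¬ F.Consistent x y z

lemma Consistent.not_bad {x y z : F.Vertex} (h : F.Consistent x y z) (hxy : x ≠ y)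
    (hyz : y ≠ z) (hxz : x ≠ z) {M : Set F.Vertex} (hx : x ∈ M) (hy : y ∈ M) (hz : z ∈ M) :
    ¬ F.Bad M := by
  rintro ⟨x', y', z', rfl, hbad⟩
  have h1 := h.swap_left
  have h2 := h.reverse
  have h3 := h1.reverse
  have h4 := h2.swap_left
  have h5 := h3.swap_left
  simp only [Set.mem_insert_iff, Set.mem_singleton_iff] at hx hy hz
  rcases hx with rfl | rfl | rfl <;> rcases hy with rfl | rfl | rfl <;>
    rcases hz with rfl | rfl | rfl <;> contradiction

lemma IsAut.bad_preimage_iff {h : Equiv.Perm F.Vertex} (hh : IsAut h) (M : Set F.Vertex) :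
    F.Bad (h ⁻¹' M) ↔ F.Bad M := by
  have hc : ∀ x y z, F.Consistent (h x) (h y) (h z) ↔ F.Consistent x y z := by
    intro x y z
    simp only [Consistent, hh.2]
  constructor
  · rintro ⟨x, y, z, hM, hbad⟩
    refine ⟨h x, h y, h z, ?_, by rwa [hc]⟩
    rw [← Equiv.image_preimage h M, hM]
    simp [Set.image_insert_eq]
  · rintro ⟨x, y, z, rfl, hbad⟩
    refine ⟨h.symm x, h.symm y, h.symm z, ?_, ?_⟩
    · ext w
      simp [Equiv.eq_symm_apply]
    · rw [← hc]
      simpa using hbad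

variable (F)

/-- The points of the representation: a vertex together with a bit for every set of
vertices; the bits rule out the triangles over bad sets. -/
abbrev Point : Type u := F.Vertex × (Set F.Vertex → Bool)

/-- The labelled edges of the representation. -/
def Edge (u v : F.Point) (a : X) : Prop :=
  (u = v ∧ a = u.1.type) ∨
    (F.Lab u.1 v.1 a ∧ ∀ M, F.Bad M → u.1 ∈ M → v.1 ∈ M → u.2 M ≠ v.2 M)

variable {F}

lemma edge_self (u : F.Point) : F.Edge u u u.1.type := Or.inl ⟨rfl, rfl⟩

lemma Edge.unique {u v : F.Point} {a b : X} (ha : F.Edge u v a) (hb : F.Edge u v b) : a = b := by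
  rcases ha with ⟨rfl, rfl⟩ | ⟨ha, -⟩ <;> rcases hb with ⟨h, rfl⟩ | ⟨hb, -⟩
  · rfl
  · exact absurd rfl hb.ne
  · exact absurd (congrArg Prod.fst h) ha.ne
  · exact ha.unique hb

lemma Edge.conv {u v : F.Point} {a : X} (h : F.Edge u v a) : F.Edge v u (F.conv a) := by
  rcases h with ⟨rfl, rfl⟩ | ⟨h, hM⟩
  · exact Or.inl ⟨rfl, F.conv_eq_self u.1.type.2⟩
  · exact Or.inr ⟨h.conv, fun M hb hv hu => (hM M hb hu hv).symm⟩

lemma Edge.src_eq {u v : F.Point} {a : X} (h : F.Edge u v a) : F.src a = u.1.type := by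
  rcases h with ⟨rfl, rfl⟩ | ⟨h, -⟩
  · exact u.1.type.2
  · exact h.2.2.1

lemma Edge.src_eq_self_iff {u v : F.Point} {a : X} (h : F.Edge u v a) :
    F.src a = a ↔ u = v := by
  rcases h with ⟨rfl, rfl⟩ | ⟨h, -⟩
  · exact iff_of_true u.1.type.2 rfl
  · exact iff_of_false h.1 fun e => h.ne (congrArg Prod.fst e)

lemma Edge.cycle {u v w : F.Point} {a b c : X} (ha : F.Edge u w a) (hb : F.Edge w v b)
    (hc : F.Edge u v c) : F.cycle a b c := by
  have hsrc := hc.src_eq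
  have hsrc' := hc.conv.src_eq
  rcases ha with ⟨rfl, rfl⟩ | ⟨ha, hMa⟩
  · obtain rfl := hb.unique hc
    rw [← hsrc]
    exact F.cycle_src b
  rcases hb with ⟨rfl, rfl⟩ | ⟨hb, hMb⟩
  · obtain rfl := Edge.unique (Or.inr ⟨ha, hMa⟩) hc
    rw [← hsrc']
    exact F.cycle_src_conv a
  rcases hc with ⟨rfl, rfl⟩ | ⟨hc, hMc⟩
  · obtain rfl := ha.conv.unique hb
    rw [← Edge.src_eq (Or.inr ⟨ha, hMa⟩)]
    exact F.cycle_conv_src a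
  by_contra hcyc
  have hbad : F.Bad {u.1, w.1, v.1} :=
    ⟨_, _, _, rfl, fun h => hcyc (h a b c ha hb hc)⟩
  have h1 := hMa _ hbad (by simp) (by simp)
  have h2 := hMb _ hbad (by simp) (by simp)
  have h3 := hMc _ hbad (by simp) (by simp)
  generalize u.2 _ = p at h1 h3
  generalize v.2 _ = q at h2 h3
  generalize w.2 _ = r at h1 h2
  revert p q r
  decide

lemma exists_edge_of_src_eq (u : F.Point) {a : X} (ha : F.src a = u.1.type) :
    ∃ w, F.Edge u w a := by
  by_cases hid : F.src a = a
  · exact ⟨u, Or.inl ⟨rfl, hid.symm.trans ha⟩⟩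
  · obtain ⟨z, hz⟩ := exists_lab u.1 hid ha
    exact ⟨(z, fun M => !u.2 M), Or.inr ⟨hz, fun M _ _ _ => by simp⟩⟩

lemma exists_edge (a : X) : ∃ u v, F.Edge u v a :=
  ⟨_, exists_edge_of_src_eq
    (⟨0, ⟨F.src a, F.src_src a⟩, 0⟩, fun _ => false) rfl⟩

open Classical in
lemma Edge.exists_of_cycle {u v : F.Point} {a b c : X} (hc : F.Edge u v c)
    (h : F.cycle a b c) : ∃ w, F.Edge u w a ∧ F.Edge w v b := by
  have hua : F.src a = u.1.type := (F.src_eq_of_cycle h).symm.trans hc.src_eq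
  have hvb : F.src (F.conv b) = v.1.type :=
    (F.src_eq_of_cycle (F.cycle_conv h)).symm.trans hc.conv.src_eq
  by_cases ha : F.src a = a
  · obtain rfl := F.eq_of_cycle_left ha h
    exact ⟨u, Or.inl ⟨rfl, ha.symm.trans hua⟩, hc⟩
  by_cases hb : F.src b = b
  · obtain rfl := F.eq_of_cycle_right hb h
    rw [F.conv_eq_self hb, hb] at hvb
    exact ⟨v, hc, Or.inl ⟨rfl, hvb⟩⟩
  by_cases huv : u = v
  · obtain rfl := huv
    obtain rfl := F.eq_conv_of_cycle (hc.src_eq_self_iff.2 rfl) h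
    obtain ⟨w, hw⟩ := exists_edge_of_src_eq u hua
    exact ⟨w, hw, hw.conv⟩
  obtain ⟨hl, hM⟩ := hc.resolve_left fun h => huv h.1
  obtain ⟨z, hz1, hz2⟩ := exists_lab_lab hl.2.1 ha hb hua (F.src_conv_of_cycle h) hvb
  have hcons : F.Consistent u.1 z v.1 := by
    intro a' b' c' ha' hb' hc'
    rwa [ha'.unique hz1, hb'.unique hz2, hc'.unique hl]
  refine ⟨(z, fun M => if u.1 ∈ M then !u.2 M else !v.2 M), Or.inr ⟨hz1, ?_⟩,
    Or.inr ⟨hz2, ?_⟩⟩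
  · intro M _ hu _
    simp [hu]
  · intro M hbad hz hv
    have hu : u.1 ∉ M := fun hu =>
      hcons.not_bad hz1.ne hz2.ne hl.ne hu hz hv hbad
    simp [hu]

/-- The lift of a permutation of the vertices to the points, twisted by `ψ`. -/
def Point.lift (h : Equiv.Perm F.Vertex) (ψ : F.Vertex → Set F.Vertex → Bool) :
    Equiv.Perm F.Point where
  toFun u := (h u.1, fun M => xor (u.2 (h ⁻¹' M)) (ψ (h u.1) M))
  invFun u := (h.symm u.1, fun M => xor (u.2 (h.symm ⁻¹' M)) (ψ u.1 (h.symm ⁻¹' M)))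
  left_inv u := by simp [← Set.preimage_comp]
  right_inv u := by simp [← Set.preimage_comp]

lemma edge_lift_iff {h : Equiv.Perm F.Vertex} (hh : IsAut h)
    {ψ : F.Vertex → Set F.Vertex → Bool}
    (hψ : ∀ M, F.Bad M → ∀ x ∈ M, ∀ y ∈ M, ψ x M = ψ y M) (u v : F.Point) (a : X) :
    F.Edge (Point.lift h ψ u) (Point.lift h ψ v) a ↔ F.Edge u v a := by
  have h1 : (Point.lift h ψ u).1 = h u.1 := rfl
  have h2 : (Point.lift h ψ v).1 = h v.1 := rfl
  unfold Edge
  rw [(Point.lift h ψ).injective.eq_iff, h1, h2, hh.1, hh.2]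
  refine or_congr Iff.rfl (and_congr Iff.rfl ⟨fun H M hM hu hv => ?_, fun H M hM hu hv => ?_⟩)
  · have hM' : h ⁻¹' (h '' M) = M := Equiv.preimage_image h M
    have hb : F.Bad (h '' M) := by rwa [← hh.bad_preimage_iff, hM']
    have hu' := Set.mem_image_of_mem h hu
    have hv' := Set.mem_image_of_mem h hv
    have := H _ hb hu' hv'
    simp only [Point.lift, Equiv.coe_fn_mk, hM', hψ _ hb _ hu' _ hv'] at this
    exact fun e => this (by rw [e])
  · have := H (h ⁻¹' M) ((hh.bad_preimage_iff M).2 hM) hu hv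
    simp only [Point.lift, Equiv.coe_fn_mk, hψ _ hM _ hu _ hv]
    exact fun e => this (Bool.xor_left_inj.1 e)

open Classical in
lemma Edge.exists_perm {u v u' v' : F.Point} {a : X} (h : F.Edge u v a) (h' : F.Edge u' v' a) :
    ∃ g : Equiv.Perm F.Point, (∀ x y b, F.Edge (g x) (g y) b ↔ F.Edge x y b) ∧
      g u = u' ∧ g v = v' := by
  by_cases huv : u = v
  · have huv' : u' = v' := h'.src_eq_self_iff.1 (h.src_eq_self_iff.2 huv)
    subst huv huv'
    obtain ⟨g, hg, hgu⟩ := exists_isAut_vertex (Subtype.ext (h.src_eq.symm.trans h'.src_eq))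
    have hL : Point.lift g (fun _ M => xor (u.2 (g ⁻¹' M)) (u'.2 M)) u = u' := by
      simp [Point.lift, hgu]
    exact ⟨_, edge_lift_iff hg fun _ _ _ _ _ _ => rfl, hL, hL⟩
  · have huv' : u' ≠ v' := fun e => huv (h.src_eq_self_iff.1 (h'.src_eq_self_iff.2 e))
    obtain ⟨hl, hM⟩ := h.resolve_left fun h => huv h.1
    obtain ⟨hl', hM'⟩ := h'.resolve_left fun h => huv' h.1
    obtain ⟨g, hg, hgu, hgv⟩ := exists_isAut_edge hl hl'
    let A : Set F.Vertex → Bool := fun M => xor (u.2 (g ⁻¹' M)) (u'.2 M)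
    let B : Set F.Vertex → Bool := fun M => xor (v.2 (g ⁻¹' M)) (v'.2 M)
    have hAB : ∀ M, F.Bad M → u'.1 ∈ M → v'.1 ∈ M → A M = B M := by
      intro M hbad hu hv
      have h1 := hM' M hbad hu hv
      have h2 := hM (g ⁻¹' M) ((hg.bad_preimage_iff M).2 hbad) (by simpa [hgu] using hu)
        (by simpa [hgv] using hv)
      simp only [A, B]
      generalize u.2 _ = p at *
      generalize v.2 _ = q at *
      generalize u'.2 _ = r at *
      generalize v'.2 _ = s at *
      clear * - h1 h2
      revert p q r s
      decide
    refine ⟨Point.lift g fun z M => if z = u'.1 then A M else if z = v'.1 then B M else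
      if u'.1 ∈ M then A M else B M, edge_lift_iff hg ?_, ?_, ?_⟩
    · intro M hbad x hx y hy
      have := hAB M hbad
      by_cases hx1 : x = u'.1 <;> by_cases hx2 : x = v'.1 <;> by_cases hy1 : y = u'.1 <;>
        by_cases hy2 : y = v'.1 <;> by_cases hu : u'.1 ∈ M <;> simp_all
    · simp [Point.lift, hgu, A]
    · simp [Point.lift, hgv, B, hl'.ne.symm]

end CycleStructure

namespace WA

variable {A : Type u} [BooleanAlgebra A] (W : WA A)

lemma comp_mono_left {x y : A} (h : x ≤ y) (z : A) : W.comp x z ≤ W.comp y z := by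
  rw [← sup_eq_right, ← W.rdist, sup_eq_right.2 h]

lemma conv_mono {x y : A} (h : x ≤ y) : W.conv x ≤ W.conv y := by
  rw [← sup_eq_right, ← W.conv_sup, sup_eq_right.2 h]

/-- Converse as an order automorphism. -/
def convIso : A ≃o A where
  toFun := W.conv
  invFun := W.conv
  left_inv := W.conv_conv
  right_inv := W.conv_conv
  map_rel_iff' {x y} :=
    ⟨fun h => by simpa [W.conv_conv] using W.conv_mono h, fun h => W.conv_mono h⟩

lemma isAtom_conv {a : A} (h : IsAtom a) : IsAtom (W.conv a) :=
  (W.convIso.isAtom_iff a).2 h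

lemma conv_le_conv_iff {x y : A} : W.conv x ≤ W.conv y ↔ x ≤ y := W.convIso.le_iff_le

lemma comp_mono_right (x : A) {y z : A} (h : y ≤ z) : W.comp x y ≤ W.comp x z := by
  rw [← W.conv_le_conv_iff, W.conv_comp, W.conv_comp]
  exact W.comp_mono_left (W.conv_mono h) _

lemma comp_mono {x x' y y' : A} (h : x ≤ x') (h' : y ≤ y') : W.comp x y ≤ W.comp x' y' :=
  (W.comp_mono_left h y).trans (W.comp_mono_right x' h')

lemma disjoint_conv_iff {x y : A} : Disjoint (W.conv x) (W.conv y) ↔ Disjoint x y :=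
  disjoint_map_orderIso_iff W.convIso

lemma disjoint_comp_rotate {x y z : A} (h : Disjoint z (W.comp x y)) :
    Disjoint y (W.comp (W.conv x) z) := by
  have h1 := W.comp_mono_right (W.conv x) (le_compl_iff_disjoint_right.2 h)
  exact (le_compl_iff_disjoint_right.1 (h1.trans (W.tarski x y))).symm

lemma disjoint_comp_iff_left {x y z : A} :
    Disjoint z (W.comp x y) ↔ Disjoint y (W.comp (W.conv x) z) :=
  ⟨W.disjoint_comp_rotate, fun h => by simpa [W.conv_conv] using W.disjoint_comp_rotate h⟩

lemma disjoint_comp_iff_right {x y z : A} :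
    Disjoint z (W.comp x y) ↔ Disjoint x (W.comp z (W.conv y)) := by
  rw [← W.disjoint_conv_iff, W.conv_comp, W.disjoint_comp_iff_left, ← W.disjoint_conv_iff,
    W.conv_comp, W.conv_conv, W.conv_conv, W.conv_conv]

lemma conv_one' : W.conv W.one' = W.one' := by
  have h := W.conv_comp (W.conv W.one') W.one'
  rw [W.comp_one', W.conv_conv, W.comp_one'] at h
  exact h.symm

lemma one'_comp (x : A) : W.comp W.one' x = x := by
  have h := W.conv_comp (W.conv x) W.one'
  rw [W.comp_one', W.conv_conv, W.conv_one'] at h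
  exact h.symm

lemma comp_le_left {x y : A} (hy : y ≤ W.one') : W.comp x y ≤ x :=
  (W.comp_mono_right x hy).trans_eq (W.comp_one' x)

lemma comp_le_right {x y : A} (hx : x ≤ W.one') : W.comp x y ≤ y :=
  (W.comp_mono_left hx y).trans_eq (W.one'_comp y)

lemma le_comp_top (x : A) : x ≤ W.comp x ⊤ :=
  (W.comp_one' x).symm.trans_le (W.comp_mono_right x le_top)

lemma comp_top_comp_top {e : A} (he : e ≤ W.one') :
    W.comp (W.comp e ⊤) ⊤ = W.comp e ⊤ := by
  simpa [inf_eq_left.2 he] using W.wassoc e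

lemma le_comp_rotate {a b c : A} (hb : IsAtom b) (hc : IsAtom c) (h : c ≤ W.comp a b) :
    b ≤ W.comp (W.conv a) c := by
  rw [← hb.not_disjoint_iff_le, ← W.disjoint_comp_iff_left, hc.not_disjoint_iff_le]
  exact h

lemma conv_top : W.conv ⊤ = ⊤ := W.convIso.map_top

lemma conv_eq_of_le_one' {e : A} (ha : IsAtom e) (he : e ≤ W.one') : W.conv e = e := by
  have h : e ≤ W.comp e e := by
    have h1 : e = W.comp e e ⊔ W.comp (W.one' \ e) e := by
      rw [← W.rdist, sup_sdiff_cancel_right he, W.one'_comp]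
    have h2 : Disjoint e (W.comp (W.one' \ e) e) :=
      disjoint_sdiff_self_right.mono_right (W.comp_le_left he)
    exact Disjoint.left_le_of_le_sup_right h1.le h2
  have h' : e ≤ W.conv e := (W.le_comp_rotate ha ha h).trans (W.comp_le_left he)
  exact (((W.isAtom_conv ha).le_iff_eq ha.1).1 h').symm

lemma eq_of_le_comp_top {e d x : A} (he : IsAtom e) (hd : IsAtom d) (he' : e ≤ W.one')
    (hd' : d ≤ W.one') (hx : x ≠ ⊥) (hxe : x ≤ W.comp e ⊤) (hxd : x ≤ W.comp d ⊤) : e = d := by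
  by_contra hne
  have h1 : W.comp (W.conv e) d = ⊥ := by
    rw [W.conv_eq_of_le_one' he he', ← le_bot_iff]
    exact (he.disjoint_of_ne hd hne) (W.comp_le_left hd') (W.comp_le_right he')
  have h2 : Disjoint d (W.comp e ⊤) := by
    rw [W.disjoint_comp_iff_left, h1]
    exact disjoint_bot_right
  have h3 : Disjoint (W.comp e ⊤) (W.comp d ⊤) := by
    rwa [W.disjoint_comp_iff_right, W.conv_top, W.comp_top_comp_top he']
  exact hx (le_bot_iff.1 (h3 hxe hxd))

lemma exists_atom_left (hatomic : ∀ x : A, x ≠ ⊥ → ∃ a : A, IsAtom a ∧ a ≤ x) {c x y : A}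
    (hc : IsAtom c) (h : c ≤ W.comp x y) : ∃ a, IsAtom a ∧ a ≤ x ∧ c ≤ W.comp a y := by
  rw [← hc.not_disjoint_iff_le, W.disjoint_comp_iff_right, disjoint_iff] at h
  obtain ⟨a, ha, hle⟩ := hatomic _ h
  refine ⟨a, ha, hle.trans inf_le_left, ?_⟩
  rw [← hc.not_disjoint_iff_le, W.disjoint_comp_iff_right, ha.not_disjoint_iff_le]
  exact hle.trans inf_le_right

lemma exists_atom_right (hatomic : ∀ x : A, x ≠ ⊥ → ∃ a : A, IsAtom a ∧ a ≤ x) {c x y : A}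
    (hc : IsAtom c) (h : c ≤ W.comp x y) : ∃ b, IsAtom b ∧ b ≤ y ∧ c ≤ W.comp x b := by
  rw [← hc.not_disjoint_iff_le, W.disjoint_comp_iff_left, disjoint_iff] at h
  obtain ⟨b, hb, hle⟩ := hatomic _ h
  refine ⟨b, hb, hle.trans inf_le_left, ?_⟩
  rw [← hc.not_disjoint_iff_le, W.disjoint_comp_iff_left, hb.not_disjoint_iff_le]
  exact hle.trans inf_le_right

lemma exists_src (hatomic : ∀ x : A, x ≠ ⊥ → ∃ a : A, IsAtom a ∧ a ≤ x) {a : A}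
    (ha : IsAtom a) : ∃ e, IsAtom e ∧ e ≤ W.one' ∧ a ≤ W.comp e a :=
  W.exists_atom_left hatomic ha (W.one'_comp a).ge

/-- The cycle structure on the atoms of an atomic weakly associative relation algebra. -/
noncomputable def cycleStructure (hatomic : ∀ x : A, x ≠ ⊥ → ∃ a : A, IsAtom a ∧ a ≤ x) :
    CycleStructure {a : A // IsAtom a} :=
  have src_unique : ∀ {e a : A} (he : IsAtom e) (ha : IsAtom a), e ≤ W.one' →
      a ≤ W.comp e ⊤ → (W.exists_src hatomic ha).choose = e := fun {e a} he ha he' h =>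
    have hs := (W.exists_src hatomic ha).choose_spec
    W.eq_of_le_comp_top hs.1 he hs.2.1 he' ha.1
      (hs.2.2.trans (W.comp_mono_right _ le_top)) h
  { cycle := fun a b c => c.1 ≤ W.comp a.1 b.1
    conv := fun a => ⟨W.conv a.1, W.isAtom_conv a.2⟩
    src := fun a => ⟨(W.exists_src hatomic a.2).choose, (W.exists_src hatomic a.2).choose_spec.1⟩
    conv_conv := fun a => Subtype.ext (W.conv_conv a.1)
    src_src := fun a =>
      have hs := (W.exists_src hatomic a.2).choose_spec
      Subtype.ext (src_unique hs.1 hs.1 hs.2.1 (W.le_comp_top _))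
    conv_src := fun a =>
      have hs := (W.exists_src hatomic a.2).choose_spec
      Subtype.ext (W.conv_eq_of_le_one' hs.1 hs.2.1)
    cycle_rotate := fun {a b c} h => W.le_comp_rotate b.2 c.2 h
    cycle_conv := fun {a b c} h => (W.conv_mono h).trans_eq (W.conv_comp _ _)
    src_eq_of_cycle := fun {a b c} h => by
      have hs := (W.exists_src hatomic a.2).choose_spec
      refine Subtype.ext (src_unique hs.1 c.2 hs.2.1 (h.trans ?_))
      rw [← W.comp_top_comp_top hs.2.1]
      exact W.comp_mono (hs.2.2.trans (W.comp_mono_right _ le_top)) le_top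
    cycle_src := fun a => (W.exists_src hatomic a.2).choose_spec.2.2
    eq_of_cycle_src := fun {a b c} h => by
      have hs := (W.exists_src hatomic a.2).choose_spec
      exact Subtype.ext ((b.2.le_iff_eq c.2.1).1 (h.trans (W.comp_le_right hs.2.1))).symm }

lemma src_eq_self_iff (hatomic : ∀ x : A, x ≠ ⊥ → ∃ a : A, IsAtom a ∧ a ≤ x)
    (a : {a : A // IsAtom a}) : (W.cycleStructure hatomic).src a = a ↔ a.1 ≤ W.one' := by
  have hs := (W.exists_src hatomic a.2).choose_spec
  constructor
  · intro h
    rw [← h]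
    exact hs.2.1
  · intro h
    exact Subtype.ext (W.eq_of_le_comp_top hs.1 a.2 hs.2.1 h a.2.1
      (hs.2.2.trans (W.comp_mono_right _ le_top)) (W.le_comp_top _))

end WA

/-- Every complete atomic weakly associative relation algebra is isomorphic to
the relativization, to a symmetric-reflexive relation `S`, of a complete
atomic set relation algebra `A'` on a set `U`. -/
theorem stmt_12 {A : Type u} [CompleteBooleanAlgebra A] (W : WA A)
    (hatomic : ∀ x : A, x ≠ ⊥ → ∃ a : A, IsAtom a ∧ a ≤ x) :
    ∃ (U : Type u) (S : Set (U × U)) (A' : Set (Set (U × U))),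
      (∀ u v : U, (u, v) ∈ S → (v, u) ∈ S) ∧
      (∀ u v : U, (u, v) ∈ S → (u, u) ∈ S ∧ (v, v) ∈ S) ∧
      idRel' ∈ A' ∧
      (∀ C : Set (Set (U × U)), C ⊆ A' → ⋃₀ C ∈ A') ∧
      (∀ R ∈ A', (Set.univ \ R) ∈ A') ∧
      (∀ R ∈ A', ∀ T ∈ A', relComp R T ∈ A') ∧
      (∀ R ∈ A', relInv R ∈ A') ∧
      ∃ G : A → Set (U × U),
        Set.range G = {X | ∃ R ∈ A', X = R ∩ S} ∧
        Function.Injective G ∧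
        (∀ x y : A, G (x ⊔ y) = G x ∪ G y) ∧
        (∀ x : A, G xᶜ = S \ G x) ∧
        (∀ x y : A, G (W.comp x y) = relComp (G x) (G y) ∩ S) ∧
        (∀ x : A, G (W.conv x) = relInv (G x) ∩ S) ∧
        G W.one' = idRel' ∩ S := by
  let F := W.cycleStructure hatomic
  let G : A → Set (F.Point × F.Point) := fun x => {p | ∃ a, F.Edge p.1 p.2 a ∧ a.1 ≤ x}
  let S : Set (F.Point × F.Point) := {p | ∃ a, F.Edge p.1 p.2 a}
  let A' : Set (Set (F.Point × F.Point)) := {R | ∀ g : Equiv.Perm F.Point,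
    (∀ x y a, F.Edge (g x) (g y) a ↔ F.Edge x y a) → ∀ x y, (g x, g y) ∈ R ↔ (x, y) ∈ R}
  refine ⟨F.Point, S, A', ?_, ?_, ?_, ?_, ?_, ?_, ?_, G, ?_, ?_, ?_, ?_, ?_, ?_, ?_⟩
  · rintro u v ⟨a, ha⟩
    exact ⟨_, ha.conv⟩
  · rintro u v -
    exact ⟨⟨_, CycleStructure.edge_self u⟩, ⟨_, CycleStructure.edge_self v⟩⟩
  · intro g _ x y
    exact g.injective.eq_iff
  · intro C hC g hg x y
    simp only [Set.mem_sUnion]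
    exact exists_congr fun R => and_congr_right fun hR => hC hR g hg x y
  · intro R hR g hg x y
    simp [hR g hg x y]
  · intro R hR T hT g hg x y
    refine ⟨fun ⟨w, h1, h2⟩ => ⟨g.symm w, ?_, ?_⟩, fun ⟨w, h1, h2⟩ =>
      ⟨g w, (hR g hg _ _).2 h1, (hT g hg _ _).2 h2⟩⟩
    · rw [← hR g hg, g.apply_symm_apply]
      exact h1
    · rw [← hT g hg, g.apply_symm_apply]
      exact h2
  · intro R hR g hg x y
    exact hR g hg y x
  · ext X
    constructor
    · rintro ⟨x, rfl⟩
      refine ⟨G x, fun g hg u v => ?_, ?_⟩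
      · simp only [G, Set.mem_ofPred_eq, hg]
      · exact (Set.inter_eq_left.2 (show G x ⊆ S from fun p ⟨a, ha, _⟩ => ⟨a, ha⟩)).symm
    · rintro ⟨R, hR, rfl⟩
      refine ⟨sSup {a | ∃ h : IsAtom a, ∃ p ∈ R, F.Edge p.1 p.2 ⟨a, h⟩}, ?_⟩
      ext ⟨u, v⟩
      constructor
      · rintro ⟨c, hc, hle⟩
        refine ⟨?_, c, hc⟩
        have hd : ¬ Disjoint c.1 (sSup {a | ∃ h : IsAtom a, ∃ p ∈ R, F.Edge p.1 p.2 ⟨a, h⟩}) :=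
          c.2.not_disjoint_iff_le.2 hle
        rw [disjoint_sSup_iff] at hd
        push Not at hd
        obtain ⟨a, ⟨ha, ⟨u', v'⟩, hp, he⟩, hca⟩ := hd
        obtain rfl : c = ⟨a, ha⟩ := Subtype.ext <| by
          by_contra hne
          exact hca (c.2.disjoint_of_ne ha hne)
        obtain ⟨g, hg, rfl, rfl⟩ := he.exists_perm hc
        exact (hR g hg u' v').2 hp
      · rintro ⟨hp, c, hc⟩
        exact ⟨c, hc, le_sSup ⟨c.2, _, hp, hc⟩⟩
  · have key : ∀ x y, G x ⊆ G y → x ≤ y := by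
      intro x y hxy
      by_contra hle
      obtain ⟨a, ha, hax⟩ := hatomic (x \ y) (by rwa [ne_eq, sdiff_eq_bot_iff])
      obtain ⟨u, v, huv⟩ := CycleStructure.exists_edge (F := F) ⟨a, ha⟩
      obtain ⟨b, hb, hby⟩ := hxy (show (u, v) ∈ G x from ⟨_, huv, hax.trans sdiff_le⟩)
      obtain rfl := huv.unique hb
      exact ha.1 (le_bot_iff.1 (disjoint_sdiff_self_left hax hby))
    exact fun x y h => le_antisymm (key x y h.le) (key y x h.ge)
  · intro x y
    ext p
    simp only [G, Set.mem_union, Set.mem_ofPred_eq, ← exists_or, ← and_or_left]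
    refine exists_congr fun a => and_congr_right fun _ => ?_
    rw [← a.2.not_disjoint_iff_le, disjoint_sup_right, not_and_or,
      a.2.not_disjoint_iff_le, a.2.not_disjoint_iff_le]
  · intro x
    ext p
    constructor
    · rintro ⟨a, ha, hle⟩
      refine ⟨⟨a, ha⟩, fun ⟨b, hb, hb'⟩ => ?_⟩
      obtain rfl := ha.unique hb
      exact a.2.1 (le_bot_iff.1 (disjoint_compl_left hle hb'))
    · rintro ⟨⟨a, ha⟩, hn⟩
      refine ⟨a, ha, ?_⟩
      rw [le_compl_iff_disjoint_right]
      by_contra hd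
      exact hn ⟨a, ha, a.2.not_disjoint_iff_le.1 hd⟩
  · intro x y
    ext ⟨u, v⟩
    constructor
    · rintro ⟨c, hc, hle⟩
      obtain ⟨a, ha, hax, hca⟩ := W.exists_atom_left hatomic c.2 hle
      obtain ⟨b, hb, hby, hcb⟩ := W.exists_atom_right hatomic c.2 hca
      obtain ⟨w, h1, h2⟩ := hc.exists_of_cycle 
        (show F.cycle ⟨a, ha⟩ ⟨b, hb⟩ c from hcb)
      exact ⟨⟨w, ⟨_, h1, hax⟩, ⟨_, h2, hby⟩⟩, c, hc⟩
    · rintro ⟨⟨w, ⟨a, ha, hax⟩, ⟨b, hb, hby⟩⟩, c, hc⟩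
      have hcyc : c.1 ≤ W.comp a.1 b.1 := ha.cycle hb hc
      exact ⟨c, hc, hcyc.trans (W.comp_mono hax hby)⟩
  · intro x
    ext ⟨u, v⟩
    constructor
    · rintro ⟨a, ha, hle⟩
      refine ⟨⟨_, ha.conv, ?_⟩, a, ha⟩
      rw [← W.conv_conv x]
      exact W.conv_mono hle
    · rintro ⟨⟨a, ha, hle⟩, -⟩
      exact ⟨_, ha.conv, W.conv_mono hle⟩
  · ext ⟨u, v⟩
    constructor
    · rintro ⟨a, ha, hle⟩
      exact ⟨ha.src_eq_self_iff.1 ((W.src_eq_self_iff hatomic a).2 hle), a, ha⟩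
    · rintro ⟨h, a, ha⟩
      exact ⟨a, ha, (W.src_eq_self_iff hatomic a).1 (ha.src_eq_self_iff.2 h)⟩
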